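/- The Lie algebra of outer derivations of U = Diff(𝒜) is abelian of dimension three: (a) the quotient of the k-vector space of k-linear derivations of U (k-linear maps d : U → U with d(uv) = d(u)v + u d(v) for all u,v ∈ U) by the subspace of inner derivations (those of the form v ↦ uv − vu for some u ∈ U) has dimension 3 over k; and (b) for any two k-linear derivations d₁, d₂ of U, the commutator d₁∘d₂ − d₂∘d₁ is an inner derivation. -/

import Mathlib

/-!
Let `k` be a field of characteristic zero, `t ∈ k`, `t ≠ 0`, and let `U = Diff 𝒜` be the
algebra presented by generators `x, y, D, E` and relations `[y,x] = 0`, `[D,x] = 0`,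
`[D,y] = y² + txy`, `[E,x] = x`, `[E,y] = y`, `[E,D] = D`.  Then the Lie algebra of outer
derivations of `U` (derivations modulo inner derivations) is abelian of dimension three.
-/

open TensorProduct

/-- Relations presenting `Diff 𝒜`; the generators are `x = ι 0`, `y = ι 1`, `D = ι 2`,
`E = ι 3`. -/
inductive DiffRel (k : Type) [Field k] (t : k) :
    FreeAlgebra k (Fin 4) → FreeAlgebra k (Fin 4) → Prop
  | yx : DiffRel k t (FreeAlgebra.ι k 1 * FreeAlgebra.ι k 0)
      (FreeAlgebra.ι k 0 * FreeAlgebra.ι k 1)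
  | Dx : DiffRel k t (FreeAlgebra.ι k 2 * FreeAlgebra.ι k 0)
      (FreeAlgebra.ι k 0 * FreeAlgebra.ι k 2)
  | Dy : DiffRel k t (FreeAlgebra.ι k 2 * FreeAlgebra.ι k 1)
      (FreeAlgebra.ι k 1 * FreeAlgebra.ι k 2 +
        (FreeAlgebra.ι k 1 * FreeAlgebra.ι k 1 + t • (FreeAlgebra.ι k 0 * FreeAlgebra.ι k 1)))
  | Ex : DiffRel k t (FreeAlgebra.ι k 3 * FreeAlgebra.ι k 0)
      (FreeAlgebra.ι k 0 * FreeAlgebra.ι k 3 + FreeAlgebra.ι k 0)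
  | Ey : DiffRel k t (FreeAlgebra.ι k 3 * FreeAlgebra.ι k 1)
      (FreeAlgebra.ι k 1 * FreeAlgebra.ι k 3 + FreeAlgebra.ι k 1)
  | ED : DiffRel k t (FreeAlgebra.ι k 3 * FreeAlgebra.ι k 2)
      (FreeAlgebra.ι k 2 * FreeAlgebra.ι k 3 + FreeAlgebra.ι k 2)

/-- The algebra `Diff 𝒜` of differential operators tangent to a central arrangement of
three lines. -/
abbrev DiffA (k : Type) [Field k] (t : k) : Type := RingQuot (DiffRel k t)

section Derivations

variable (k : Type) [Field k] (A : Type) [Ring A] [Algebra k A]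

/-- The `k`-vector space of `k`-linear derivations of an associative `k`-algebra `A`. -/
def derivations : Submodule k (A →ₗ[k] A) where
  carrier := {d | ∀ u v : A, d (u * v) = d u * v + u * d v}
  add_mem' := by
    intro d e hd he u v
    simp only [LinearMap.add_apply, hd u v, he u v, add_mul, mul_add]
    abel
  zero_mem' := by
    intro u v
    simp
  smul_mem' := by
    intro c d hd u v
    simp only [LinearMap.smul_apply, hd u v, smul_add, smul_mul_assoc, mul_smul_comm]

/-- The subspace of inner derivations, i.e. maps of the form `v ↦ u * v - v * u`. -/
def innerDerivations : Submodule k (A →ₗ[k] A) where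
  carrier := {d | ∃ u : A, ∀ v : A, d v = u * v - v * u}
  add_mem' := by
    rintro d e ⟨a, ha⟩ ⟨b, hb⟩
    refine ⟨a + b, fun v => ?_⟩
    simp only [LinearMap.add_apply, ha v, hb v, add_mul, mul_add]
    abel
  zero_mem' := ⟨0, fun v => by simp⟩
  smul_mem' := by
    rintro c d ⟨a, ha⟩
    refine ⟨c • a, fun v => ?_⟩
    simp only [LinearMap.smul_apply, ha v, smul_sub, smul_mul_assoc, mul_smul_comm]

end Derivations

set_option maxSynthPendingDepth 3


namespace DA
open MvPolynomial

noncomputable section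

section rep
variable (k : Type) [Field k] (t : k)

abbrev RR := MvPolynomial (Fin 3) (Polynomial k)

def del : Derivation (Polynomial k) (RR k) (RR k) :=
  ((X 1 : RR k) ^ 2 + C (Polynomial.C t) * X 0 * X 1) • pderiv 1

def eu : Derivation (Polynomial k) (RR k) (RR k) :=
  (X 0 : RR k) • pderiv 0 + (X 1 : RR k) • pderiv 1 + (X 2 : RR k) • pderiv 2

def ops : Fin 4 → Module.End (Polynomial k) (RR k) :=
  ![LinearMap.mulLeft _ (X 0), LinearMap.mulLeft _ (X 1),
    LinearMap.mulLeft _ (X 2) + (del k t).toLinearMap,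
    (Polynomial.X : Polynomial k) • LinearMap.id + (eu k).toLinearMap]

@[simp] lemma del0 : del k t (X 0) = 0 := by simp [del, pderiv_X]
@[simp] lemma del1 : del k t (X 1) = (X 1 : RR k) ^ 2 + C (Polynomial.C t) * X 0 * X 1 := by
  simp [del, pderiv_X]
@[simp] lemma del2 : del k t (X 2) = 0 := by simp [del, pderiv_X]
@[simp] lemma delC (p : Polynomial k) : del k t (C p) = 0 := by simp [del]
@[simp] lemma eu0 : eu k (X 0) = X 0 := by simp [eu, pderiv_X]
@[simp] lemma eu1 : eu k (X 1) = X 1 := by simp [eu, pderiv_X]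
@[simp] lemma eu2 : eu k (X 2) = X 2 := by simp [eu, pderiv_X]
@[simp] lemma euC (p : Polynomial k) : eu k (C p) = 0 := by simp [eu]

lemma eu_del (f : RR k) : eu k (del k t f) = del k t (eu k f) + del k t f := by
  have : ⁅eu k, del k t⁆ = del k t := by
    apply derivation_ext
    intro i
    fin_cases i <;> simp [Derivation.commutator_apply, Derivation.leibniz, pow_two]
    ring
  have h := congrArg (fun d : Derivation (Polynomial k) (RR k) (RR k) => d f) this
  simp only [Derivation.commutator_apply] at h
  linear_combination h

lemma eu_pd (i : Fin 3) (f : RR k) : eu k (pderiv i f) = pderiv i (eu k f) - pderiv i f := by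
  have : ⁅eu k, (pderiv i : Derivation (Polynomial k) (RR k) (RR k))⁆ = - pderiv i := by
    apply derivation_ext
    intro j
    fin_cases i <;> fin_cases j <;>
      simp [Derivation.commutator_apply, pderiv_X]
  have h := congrArg (fun d : Derivation (Polynomial k) (RR k) (RR k) => d f) this
  simp only [Derivation.commutator_apply, Derivation.neg_apply] at h
  linear_combination h

lemma ops0 (f : RR k) : ops k t 0 f = X 0 * f := rfl
lemma ops1 (f : RR k) : ops k t 1 f = X 1 * f := rfl
lemma ops2 (f : RR k) : ops k t 2 f = X 2 * f + del k t f := rfl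
lemma ops3 (f : RR k) : ops k t 3 f = C Polynomial.X * f + eu k f := by
  rw [← smul_eq_C_mul]; rfl

def rho : DiffA k t →ₐ[k] Module.End (Polynomial k) (RR k) :=
  RingQuot.liftAlgHom k ⟨FreeAlgebra.lift k (ops k t), by
    intro a b h
    induction h <;> apply LinearMap.ext <;> intro f <;>
      simp only [map_mul, map_add, map_smul, FreeAlgebra.lift_ι_apply, Module.End.mul_apply,
        LinearMap.add_apply, LinearMap.smul_apply, ops0, ops1, ops2, ops3, Derivation.leibniz,
        del0, del1, delC, eu0, eu1, eu2, smul_eq_mul, map_add, eu_del]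
    · ring
    · ring
    · have : t • (X 0 * (X 1 * f) : RR k) = C (Polynomial.C t) * (X 0 * (X 1 * f)) := by
        rw [← smul_eq_C_mul, ← mul_one (Polynomial.C t), ← Polynomial.smul_eq_C_mul, smul_assoc, one_smul]
      rw [this]; ring
    · ring
    · ring
    · ring⟩

def g (i : Fin 4) : DiffA k t := RingQuot.mkAlgHom k (DiffRel k t) (FreeAlgebra.ι k i)

lemma rho_g (i : Fin 4) : rho k t (g k t i) = ops k t i := by
  simp [rho, g]

lemma rel_yx : g k t 1 * g k t 0 = g k t 0 * g k t 1 := by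
  simpa [g] using RingQuot.mkAlgHom_rel k (DiffRel.yx (k := k) (t := t))
lemma rel_Dx : g k t 2 * g k t 0 = g k t 0 * g k t 2 := by
  simpa [g] using RingQuot.mkAlgHom_rel k (DiffRel.Dx (k := k) (t := t))
lemma rel_Dy : g k t 2 * g k t 1 = g k t 1 * g k t 2 +
    (g k t 1 * g k t 1 + t • (g k t 0 * g k t 1)) := by
  simpa [g] using RingQuot.mkAlgHom_rel k (DiffRel.Dy (k := k) (t := t))
lemma rel_Ex : g k t 3 * g k t 0 = g k t 0 * g k t 3 + g k t 0 := by
  simpa [g] using RingQuot.mkAlgHom_rel k (DiffRel.Ex (k := k) (t := t))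
lemma rel_Ey : g k t 3 * g k t 1 = g k t 1 * g k t 3 + g k t 1 := by
  simpa [g] using RingQuot.mkAlgHom_rel k (DiffRel.Ey (k := k) (t := t))
lemma rel_ED : g k t 3 * g k t 2 = g k t 2 * g k t 3 + g k t 2 := by
  simpa [g] using RingQuot.mkAlgHom_rel k (DiffRel.ED (k := k) (t := t))

lemma ind {P : DiffA k t → Prop} (hs : ∀ c : k, P (algebraMap k _ c)) (hg : ∀ i, P (g k t i))
    (hm : ∀ a b, P a → P b → P (a * b)) (ha : ∀ a b, P a → P b → P (a + b)) (u) : P u := by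
  obtain ⟨a, rfl⟩ := RingQuot.mkAlgHom_surjective k (DiffRel k t) u
  induction a using FreeAlgebra.induction with
  | grade0 c => simpa using hs c
  | grade1 i => exact hg i
  | mul a b h1 h2 => simpa using hm _ _ h1 h2
  | add a b h1 h2 => simpa using ha _ _ h1 h2

/-- The PBW map. -/
def psi : RR k →ₗ[k] DiffA k t :=
  Finsupp.lsum k (fun s : Fin 3 →₀ ℕ =>
    (LinearMap.mulLeft k (g k t 0 ^ s 0 * g k t 1 ^ s 1 * g k t 2 ^ s 2)).comp
      (Polynomial.aeval (R := k) (g k t 3)).toLinearMap)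
    ∘ₗ (AddMonoidAlgebra.coeffLinearEquiv k).toLinearMap

lemma psi_mon (s : Fin 3 →₀ ℕ) (p : Polynomial k) : psi k t (monomial s p) =
    g k t 0 ^ s 0 * g k t 1 ^ s 1 * g k t 2 ^ s 2 * Polynomial.aeval (g k t 3) p := by
  exact (sum_monomial_eq (by simp)).trans (by simp [mul_assoc])

lemma mon_eq (s : Fin 3 →₀ ℕ) (p : Polynomial k) : (monomial s p : RR k) =
    X 0 ^ s 0 * X 1 ^ s 1 * X 2 ^ s 2 * C p := by
  rw [monomial_eq, Finsupp.prod_fintype _ _ (by simp), Fin.prod_univ_three]; ring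

lemma psi_prod (a b c : ℕ) (p : Polynomial k) :
    psi k t (X 0 ^ a * X 1 ^ b * X 2 ^ c * C p) =
    g k t 0 ^ a * g k t 1 ^ b * g k t 2 ^ c * Polynomial.aeval (g k t 3) p := by
  have := psi_mon k t (Finsupp.equivFunOnFinite.symm ![a, b, c]) p
  rw [mon_eq] at this
  simpa using this

lemma rind {P : RR k → Prop} (hm : ∀ a b c p, P (X 0 ^ a * X 1 ^ b * X 2 ^ c * C p))
    (ha : ∀ a b, P a → P b → P (a + b)) (f) : P f := by
  induction f using MvPolynomial.induction_on' with
  | monomial s p => rw [mon_eq]; exact hm _ _ _ _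
  | add a b h1 h2 => exact ha _ _ h1 h2

end rep
end
end DA


namespace DA
open MvPolynomial

noncomputable section

section gen
variable {k : Type} [Field k] {U : Type} [Ring U] [Algebra k U]

lemma Epow {z E : U} (h : E * z = z * E + z) (n : ℕ) : E * z ^ n = z ^ n * E + n • z ^ n := by
  induction n with
  | zero => simp
  | succ n ih =>
    rw [pow_succ, ← mul_assoc, ih, add_mul, mul_assoc, h]
    simp only [mul_add, smul_mul_assoc, add_smul, one_smul, mul_assoc]
    abel

lemma Dpow {x y D : U} {t : k} (h0 : y * x = x * y)
    (h : D * y = y * D + (y * y + t • (x * y))) (n : ℕ) :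
    D * y ^ n = y ^ n * D + n • (y ^ (n + 1) + t • (x * y ^ n)) := by
  induction n with
  | zero => simp
  | succ n ih =>
    have hc : y ^ n * x = x * y ^ n := (Commute.pow_left (show Commute y x from h0) n)
    have hc' : y ^ n * (x * y) = x * y ^ n * y := by rw [← mul_assoc, hc]
    have e : D * y ^ (n+1) = (D * y ^ n) * y := by rw [pow_succ, mul_assoc]
    rw [e, ih, add_mul, mul_assoc (y ^ n) D y, h, mul_add, mul_add, mul_smul_comm, hc']
    simp only [pow_succ, add_mul, mul_assoc, smul_mul_assoc, add_smul, one_smul, smul_add]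
    abel

end gen

section rep
variable (k : Type) [Field k] (t : k)

lemma psi_ops (i : Fin 4) (f : RR k) : psi k t (ops k t i f) = g k t i * psi k t f := by
  induction f using rind with
  | ha a b h1 h2 => rw [map_add, map_add, map_add, mul_add, h1, h2]
  | hm a b c p =>
    have cyx : Commute (g k t 1) (g k t 0) := rel_yx k t
    have cDx : Commute (g k t 2) (g k t 0) := rel_Dx k t
    rw [psi_prod]
    fin_cases i
    · change psi k t (ops k t 0 _) = g k t 0 * _
      have : ops k t 0 (X 0 ^ a * X 1 ^ b * X 2 ^ c * C p) =
        X 0 ^ (a+1) * X 1 ^ b * X 2 ^ c * C p := by rw [ops0]; ring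
      rw [this, psi_prod]
      simp only [pow_succ', mul_assoc]
    · change psi k t (ops k t 1 _) = g k t 1 * _
      have : ops k t 1 (X 0 ^ a * X 1 ^ b * X 2 ^ c * C p) =
        X 0 ^ a * X 1 ^ (b+1) * X 2 ^ c * C p := by rw [ops1]; ring
      rw [this, psi_prod]
      have e : g k t 0 ^ a * g k t 1 = g k t 1 * g k t 0 ^ a := ((cyx.pow_right a).eq).symm
      simp only [pow_succ', mul_assoc]
      rw [← mul_assoc (g k t 0 ^ a) (g k t 1), e, mul_assoc]
    · change psi k t (ops k t 2 _) = g k t 2 * _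
      have : ops k t 2 (X 0 ^ a * X 1 ^ b * X 2 ^ c * C p) =
        X 0 ^ a * X 1 ^ b * X 2 ^ (c+1) * C p + (b • (X 0 ^ a * X 1 ^ (b+1) * X 2 ^ c * C p)
          + b • t • (X 0 ^ (a+1) * X 1 ^ b * X 2 ^ c * C p)) := by
        have h1 : ∀ f : RR k, t • f = C (Polynomial.C t) * f := fun f => by
          rw [← smul_eq_C_mul, ← mul_one (Polynomial.C t), ← Polynomial.smul_eq_C_mul, smul_assoc,
            one_smul]
        rw [ops2, h1]
        simp only [Derivation.leibniz, Derivation.leibniz_pow, del0, del1, del2, delC,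
          smul_eq_mul, nsmul_eq_mul]
        rcases b with _ | b
        · simp; ring
        · simp; ring
      rw [this]
      simp only [map_add, map_nsmul, map_smul, psi_prod]
      have e : g k t 2 * g k t 0 ^ a = g k t 0 ^ a * g k t 2 := (cDx.pow_right a).eq
      simp only [← mul_assoc]
      rw [e, mul_assoc (g k t 0 ^ a) (g k t 2), Dpow (rel_yx k t) (rel_Dy k t)]
      simp only [mul_add, add_mul, mul_assoc, pow_succ, pow_succ' (g k t 2), smul_add,
        smul_mul_assoc, mul_smul_comm]
      try abel
    · change psi k t (ops k t 3 _) = g k t 3 * _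
      have : ops k t 3 (X 0 ^ a * X 1 ^ b * X 2 ^ c * C p) =
        X 0 ^ a * X 1 ^ b * X 2 ^ c * C (Polynomial.X * p + (a + b + c : ℕ) • p) := by
        rw [ops3]
        simp only [Derivation.leibniz, Derivation.leibniz_pow, eu0, eu1, eu2, euC,
          smul_eq_mul, nsmul_eq_mul, map_add, map_mul, map_natCast]
        have h : ∀ (n : ℕ) (z : RR k), (n : RR k) * (z ^ (n - 1) * z) = n * z ^ n := by
          intro n z
          rcases n with _ | n
          · simp
          · simp [pow_succ]
        simp only [h]
        push_cast
        ring
      rw [this, psi_prod]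
      simp only [← mul_assoc]
      rw [Epow (rel_Ex k t), add_mul, mul_assoc (g k t 0 ^ a) (g k t 3), Epow (rel_Ey k t)]
      simp only [add_mul, mul_add, mul_assoc]
      rw [← mul_assoc (g k t 3) (g k t 2 ^ c), Epow (rel_ED k t)]
      simp only [add_mul, mul_add, mul_assoc, map_add, map_mul, Polynomial.aeval_X, map_nsmul,
        add_smul, smul_mul_assoc, mul_smul_comm]
      abel

lemma psi_rho (u : DiffA k t) (f : RR k) : psi k t (rho k t u f) = u * psi k t f := by
  induction u using ind generalizing f with
  | hs c => rw [AlgHom.commutes, Module.algebraMap_end_apply, map_smul, Algebra.smul_def]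
  | hg i => rw [rho_g, psi_ops]
  | hm a b h1 h2 => rw [map_mul, Module.End.mul_apply, h1, h2, mul_assoc]
  | ha a b h1 h2 => rw [map_add, LinearMap.add_apply, map_add, h1, h2, add_mul]

/-- symbol map -/
def phi : DiffA k t →ₗ[k] RR k where
  toFun u := rho k t u 1
  map_add' a b := by simp
  map_smul' a b := by simp

lemma phi_mul (u v : DiffA k t) : phi k t (u * v) = rho k t u (phi k t v) := by
  simp [phi]

lemma psi_one : psi k t 1 = 1 := by simpa using psi_prod k t 0 0 0 1

lemma psi_phi (u : DiffA k t) : psi k t (phi k t u) = u := by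
  have := psi_rho k t u 1
  rw [psi_one, mul_one] at this
  exact this

lemma phi_inj : Function.Injective (phi k t) :=
  Function.LeftInverse.injective (psi_phi k t)

lemma phi_aeval (p : Polynomial k) : phi k t (Polynomial.aeval (g k t 3) p) = C p := by
  induction p using Polynomial.induction_on' with
  | add p q h1 h2 => rw [map_add, map_add, h1, h2, map_add]
  | monomial n c =>
    rw [← Polynomial.C_mul_X_pow_eq_monomial, map_mul, Polynomial.aeval_C, ← Algebra.smul_def,
      map_smul, map_pow, Polynomial.aeval_X]
    have : phi k t (g k t 3 ^ n) = C (Polynomial.X ^ n) := by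
      induction n with
      | zero => simp [phi]
      | succ n ih => rw [pow_succ', phi_mul, ih, rho_g, ops3, euC, pow_succ']; simp
    rw [this, ← Polynomial.smul_eq_C_mul]
    rw [← algebraMap_eq, Algebra.algebraMap_eq_smul_one,
      Algebra.algebraMap_eq_smul_one, smul_assoc]

lemma phi_psi (f : RR k) : phi k t (psi k t f) = f := by
  induction f using rind with
  | ha a b h1 h2 => rw [map_add, map_add, h1, h2]
  | hm a b c p =>
    rw [psi_prod]
    simp only [mul_assoc]
    induction a with
    | succ a ih => rw [pow_succ', mul_assoc, phi_mul, ih, rho_g, ops0, pow_succ', mul_assoc]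
    | zero =>
    induction b with
    | succ a ih =>
      simp only [pow_zero, one_mul] at ih ⊢
      rw [pow_succ', mul_assoc, phi_mul, ih, rho_g, ops1, pow_succ', mul_assoc]
    | zero =>
    induction c with
    | succ a ih =>
      simp only [pow_zero, one_mul] at ih ⊢
      rw [pow_succ', mul_assoc, phi_mul, ih, rho_g, ops2, pow_succ', mul_assoc]
      simp
    | zero => simpa using phi_aeval k t p

lemma phi_right (u : DiffA k t) (p : Polynomial k) :
    phi k t (u * Polynomial.aeval (g k t 3) p) = C p * phi k t u := by
  have h : (C p : RR k) = p • 1 := by rw [smul_eq_C_mul, mul_one]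
  rw [phi_mul, phi_aeval, h, map_smul, smul_eq_C_mul, smul_eq_C_mul, mul_one]
  rfl

lemma phi_comm (u : DiffA k t) : phi k t (g k t 3 * u - u * g k t 3) = eu k (phi k t u) := by
  have := phi_right k t u Polynomial.X
  rw [Polynomial.aeval_X] at this
  rw [map_sub, this, phi_mul, rho_g, ops3]; ring

end rep
end
end DA


namespace DA
open MvPolynomial

noncomputable section

section rep
variable (k : Type) [Field k] (t : k)

lemma eu_mon (s : Fin 3 →₀ ℕ) (p : Polynomial k) :
    eu k (monomial s p) = (s 0 + s 1 + s 2) • monomial s p := by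
  rw [mon_eq]
  simp only [Derivation.leibniz, Derivation.leibniz_pow, eu0, eu1, eu2, euC,
    smul_eq_mul, nsmul_eq_mul]
  have h : ∀ (n : ℕ) (z : RR k), (n : RR k) * (z ^ (n - 1) * z) = n * z ^ n := by
    intro n z
    rcases n with _ | n
    · simp
    · simp [pow_succ]
  simp only [h]
  push_cast
  ring

lemma coeff_eu (s : Fin 3 →₀ ℕ) (f : RR k) :
    coeff s (eu k f) = (s 0 + s 1 + s 2) • coeff s f := by
  induction f using MvPolynomial.induction_on' with
  | monomial r p =>
    rw [eu_mon, coeff_smul, coeff_monomial]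
    split_ifs with h
    · rw [h]
    · simp
  | add a b h1 h2 => rw [map_add, coeff_add, coeff_add, h1, h2, smul_add]

lemma wt_zero {s : Fin 3 →₀ ℕ} (h : s 0 + s 1 + s 2 = 0) : s = 0 := by
  ext i
  fin_cases i <;> simp <;> omega

lemma phi_gp (p) (i : Fin 4) : phi k t (g k t i * Polynomial.aeval (R := k) (g k t 3) p) = C p * ops k t i 1 := by
  rw [phi_right, ← mul_one (g k t i), phi_mul, rho_g]; simp [phi]

lemma phi_ggp (p) (i j : Fin 4) : phi k t (g k t i * g k t j * Polynomial.aeval (R := k) (g k t 3) p) =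
    C p * ops k t i (ops k t j 1) := by
  rw [phi_right, ← mul_one (g k t j), phi_mul, phi_mul, rho_g, rho_g]; simp [phi]

variable [CharZero k]

lemma euH0 (f : RR k) : ∃ h, eu k (f - eu k h) = 0 := by
  induction f using MvPolynomial.induction_on' with
  | monomial s p =>
    by_cases hs : s 0 + s 1 + s 2 = 0
    · exact ⟨0, by rw [map_zero, sub_zero, eu_mon, hs, zero_smul]⟩
    · refine ⟨((s 0 + s 1 + s 2 : ℕ) : k)⁻¹ • monomial s p, ?_⟩
      have : eu k (((s 0 + s 1 + s 2 : ℕ) : k)⁻¹ • monomial s p) = monomial s p := by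
        have h1 : ((s 0 + s 1 + s 2 : ℕ) : k)⁻¹ • (monomial s p : RR k) =
          monomial s (((s 0 + s 1 + s 2 : ℕ) : k)⁻¹ • p) := by rw [smul_monomial]
        rw [h1, eu_mon, ← h1, ← Nat.cast_smul_eq_nsmul k, smul_smul, mul_inv_cancel₀, one_smul]
        exact_mod_cast hs
      rw [this, sub_self, map_zero]
  | add a b h1 h2 =>
    obtain ⟨x, hx⟩ := h1
    obtain ⟨y, hy⟩ := h2
    refine ⟨x + y, ?_⟩
    have : a + b - eu k (x + y) = (a - eu k x) + (b - eu k y) := by rw [map_add]; ring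
    rw [this, map_add, hx, hy, add_zero]

lemma euH1 {f : RR k} (h : eu k f = 0) : f = C (coeff 0 f) := by
  ext1 s
  rw [coeff_C]
  split_ifs with hs
  · rw [hs]
  · have := coeff_eu k s f
    rw [h, coeff_zero, eq_comm, smul_eq_zero] at this
    rcases this with h | h
    · exact absurd (wt_zero h).symm hs
    · exact h

lemma euH2 {f : RR k} (h : eu k f = f) : ∃ p q r, f = C p * X 0 + C q * X 1 + C r * X 2 := by
  have e : ∀ i, eu k (pderiv i f) = 0 := fun i => by rw [eu_pd, h, sub_self]
  refine ⟨coeff 0 (pderiv 0 f), coeff 0 (pderiv 1 f), coeff 0 (pderiv 2 f), ?_⟩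
  · conv_lhs => rw [← h]
    simp only [eu, Derivation.add_apply, Derivation.smul_apply, smul_eq_mul]
    rw [← euH1 k (e 0), ← euH1 k (e 1), ← euH1 k (e 2), mul_comm (X 0), mul_comm (X 1), mul_comm (X 2)]

lemma euH3 {f h : RR k} (h1 : eu k f - f = h) (h2 : eu k h = h) : h = 0 := by
  ext1 s
  have e1 := congrArg (coeff s) h1
  have e2 := congrArg (coeff s) h2
  rw [coeff_sub, coeff_eu] at e1
  rw [coeff_eu] at e2
  rw [coeff_zero]
  by_cases hs : s 0 + s 1 + s 2 = 1
  · rw [hs, one_smul, sub_self] at e1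
    exact e1.symm
  · have : (((s 0 + s 1 + s 2 : ℕ) : ℤ) - 1) • coeff s h = 0 := by
      rw [sub_smul, natCast_zsmul, e2, one_smul, sub_self]
    rcases smul_eq_zero.1 this with h | h
    · omega
    · exact h

lemma euH6 {f : RR k} (h1 : eu k (eu k f) = 0) : eu k f = 0 := by
  ext1 s
  have e1 := congrArg (coeff s) h1
  rw [coeff_eu, coeff_zero] at e1
  rcases smul_eq_zero.1 e1 with h | h
  · rw [coeff_eu, h, zero_smul, coeff_zero]
  · exact h

lemma euH4 {p1 p2 p3 p4 p5 p6 : Polynomial k}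
    (h : C p1 * (X 0 * X 0) + C p2 * (X 0 * X 1) + C p3 * (X 1 * X 1) + C p4 * (X 0 * X 2)
      + C p5 * (X 1 * X 2) + C p6 * (X 2 * X 2) = (0 : RR k)) :
    p1 = 0 ∧ p2 = 0 ∧ p3 = 0 ∧ p4 = 0 ∧ p5 = 0 ∧ p6 = 0 := by
  have H : ∀ i j : Fin 3, _ := fun i j => congrArg (fun f => pderiv i (pderiv j f)) h
  have h1 := H 0 0
  have h2 := H 0 1
  have h3 := H 1 1
  have h4 := H 0 2
  have h5 := H 1 2
  have h6 := H 2 2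
  clear H h
  have z : ∀ i, pderiv i (2 : RR k) = 0 := fun i => by
    simpa using Derivation.map_natCast (pderiv i : Derivation (Polynomial k) (RR k) (RR k)) 2
  simp [pderiv_X, ← two_mul, z] at h1 h2 h3 h4 h5 h6
  exact ⟨h1, h2, h3, h4, h5, h6⟩

local notation "x" => g k t 0
local notation "y" => g k t 1
local notation "D" => g k t 2
local notation "E" => g k t 3
local notation "A" => Polynomial.aeval (R := k) (g k t 3)

lemma H0 (v : DiffA k t) : ∃ u : DiffA k t, E * (v - (E * u - u * E)) = (v - (E * u - u * E)) * E := by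
  obtain ⟨h, hh⟩ := euH0 k (phi k t v)
  refine ⟨psi k t h, ?_⟩
  rw [← sub_eq_zero]
  apply phi_inj
  rw [phi_comm, map_zero, map_sub, phi_comm, phi_psi, hh]

lemma H1 {u : DiffA k t} (h : E * u = u * E) : ∃ p, u = A p := by
  rw [← sub_eq_zero] at h
  have := congrArg (phi k t) h
  rw [phi_comm, map_zero] at this
  refine ⟨coeff 0 (phi k t u), phi_inj k t ?_⟩
  · rw [phi_aeval]
    exact euH1 k this

lemma H2 {u : DiffA k t} (h : E * u - u * E = u) :
    ∃ p q r, u = x * A p + y * A q + D * A r := by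
  have := congrArg (phi k t) h
  rw [phi_comm] at this
  obtain ⟨p, q, r, e⟩ := euH2 k this
  refine ⟨p, q, r, phi_inj k t ?_⟩
  rw [e, map_add, map_add, phi_gp, phi_gp, phi_gp, ops0, ops1, ops2]
  simp

lemma H3 {v w : DiffA k t} (h1 : E * v - v * E - v = w) (h2 : E * w - w * E = w) : w = 0 := by
  apply phi_inj k t
  rw [map_zero]
  refine euH3 k (f := phi k t v) ?_ ?_
  · rw [← phi_comm, ← h1, map_sub (phi k t) _ v]
  · rw [← phi_comm, h2]

lemma H6 {u : DiffA k t} (h1 : E * (E * u - u * E) = (E * u - u * E) * E) : E * u = u * E := by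
  rw [← sub_eq_zero] at h1 ⊢
  apply phi_inj k t
  have := congrArg (phi k t) h1
  rw [phi_comm, phi_comm, map_zero] at this
  rw [phi_comm, map_zero, euH6 k this]

lemma H4 {p1 p2 p3 p4 p5 p6 : Polynomial k}
    (h : x * x * A p1 + x * y * A p2 + y * y * A p3 + x * D * A p4
      + y * D * A p5 + D * D * A p6 = 0) :
    p1 = 0 ∧ p2 = 0 ∧ p3 = 0 ∧ p4 = 0 ∧ p5 = 0 ∧ p6 = 0 := by
  apply euH4
  have := congrArg (phi k t) h
  simp only [map_add, phi_ggp, map_zero, ops0, ops1, ops2] at this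
  simpa using this

lemma H5 {p : Polynomial k} (h : x * A p = 0) : p = 0 := by
  have := congrArg (phi k t) h
  rw [phi_gp, ops0, map_zero] at this
  simpa using this

end rep

section poly
variable {k : Type} [Field k] [CharZero k]

lemma shift_const {p : Polynomial k} (h : p.comp (Polynomial.X + 1) = p) : ∃ c, p = Polynomial.C c := by
  refine ⟨p.eval 0, ?_⟩
  have hn : ∀ n : ℕ, p.eval (n : k) = p.eval 0 := by
    intro n
    induction n with
    | zero => simp
    | succ n ih =>
      have := congrArg (Polynomial.eval (n : k)) h
      rw [Polynomial.eval_comp] at this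
      simp at this
      push_cast
      rw [this, ih]
  apply Polynomial.eq_of_infinite_eval_eq
  refine Set.Infinite.mono ?_ (Set.infinite_range_of_injective (Nat.cast_injective (R := k)))
  rintro _ ⟨n, rfl⟩
  simp [hn]

lemma shift_surj (p : Polynomial k) : ∃ q : Polynomial k, q.comp (Polynomial.X + 1) - q = p := by
  induction p using Polynomial.induction_on' with
  | add a b h1 h2 =>
    obtain ⟨x, hx⟩ := h1
    obtain ⟨y, hy⟩ := h2
    exact ⟨x + y, by rw [← hx, ← hy, Polynomial.add_comp]; ring⟩
  | monomial n c =>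
    have h := congrArg (Polynomial.map (algebraMap ℚ k)) (Polynomial.bernoulli_comp_one_add_X (n + 1))
    rw [Polynomial.map_comp] at h
    refine ⟨Polynomial.C (c / (n + 1)) * (Polynomial.bernoulli (n+1)).map (algebraMap ℚ k), ?_⟩
    have e : (1 + Polynomial.X : Polynomial ℚ).map (algebraMap ℚ k) = Polynomial.X + 1 := by simp [add_comm]
    rw [e] at h
    rw [Polynomial.mul_comp, h, Polynomial.C_comp, ← Polynomial.C_mul_X_pow_eq_monomial]
    have h0 : (n + 1 : k) ≠ 0 := by exact_mod_cast Nat.succ_ne_zero n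
    have h2 : Polynomial.C c = Polynomial.C (c / (n+1)) * ((n : Polynomial k) + 1) := by
      rw [← Polynomial.C_eq_natCast, ← Polynomial.C_1, ← Polynomial.C_add, ← Polynomial.C_mul,
        div_mul_cancel₀ _ h0]
    rw [h2]
    simp
    ring

end poly
end
end DA


namespace DA

noncomputable section

section main
variable (k : Type) [Field k] (t : k)

local notation "x" => g k t 0
local notation "y" => g k t 1
local notation "D" => g k t 2
local notation "E" => g k t 3
local notation "A" => Polynomial.aeval (R := k) (g k t 3)

/-- shift -/
def sh (p : Polynomial k) : Polynomial k := p.comp (Polynomial.X + 1)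

lemma Arel {z : DiffA k t} (h : E * z = z * E + z) (p : Polynomial k) :
    A p * z = z * A (sh k p) := by
  have hs : SemiconjBy z (E + 1) E := by
    change z * (E + 1) = E * z
    rw [h, mul_add, mul_one]
  rw [sh, Polynomial.aeval_comp]
  simp only [map_add, Polynomial.aeval_X, map_one]
  induction p using Polynomial.induction_on' with
  | add a b h1 h2 => rw [map_add, map_add, add_mul, mul_add, h1, h2]
  | monomial n c =>
    rw [Polynomial.aeval_monomial, Polynomial.aeval_monomial, mul_assoc, ← (hs.pow_right n).eq,
      ← mul_assoc, ← mul_assoc, Algebra.commutes]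

lemma AE (p : Polynomial k) : E * A p = A p * E := by
  have h : A (Polynomial.X * p) = A (p * Polynomial.X) := by rw [mul_comm]
  rw [map_mul, map_mul, Polynomial.aeval_X] at h
  exact h

lemma AC (c : k) : A (Polynomial.C c) = c • 1 := by
  rw [Polynomial.aeval_C, Algebra.algebraMap_eq_smul_one]

variable [CharZero k]

lemma Nz {d : DiffA k t →ₗ[k] DiffA k t} (hd : d ∈ derivations k (DiffA k t))
    {f : Polynomial k} (hf : d E = A f) {z : DiffA k t} (h : E * z = z * E + z) :
    z * A (f - sh k f) = 0 ∧ E * d z - d z * E = d z := by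
  have h1 := congrArg d h
  rw [map_add, hd, hd, hf, Arel k t h] at h1
  have e : E * d z - d z * E - d z = z * A (f - sh k f) := by
    rw [map_sub, mul_sub, sub_sub, sub_eq_sub_iff_add_eq_add, ← sub_eq_zero,
      ← sub_eq_zero_of_eq h1]
    abel
  have h0 := H3 k t e (by
    rw [← mul_assoc, h, mul_assoc z _ E, ← AE, add_mul, mul_assoc]; abel)
  rw [h0] at e
  exact ⟨h0, sub_eq_zero.1 e⟩

lemma R1 {a1 a2 a3 b1 b2 b3 : Polynomial k}
    (h : (x * A b1 + y * A b2 + D * A b3) * x + y * (x * A a1 + y * A a2 + D * A a3) =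
      (x * A a1 + y * A a2 + D * A a3) * y + x * (x * A b1 + y * A b2 + D * A b3)) :
    sh k b1 - b1 = 0 ∧ sh k b2 - b2 + a1 - sh k a1 - t • sh k a3 = 0 ∧
      a2 - sh k a2 - sh k a3 = 0 ∧ sh k b3 - b3 = 0 ∧ a3 - sh k a3 = 0 ∧
      (0 : Polynomial k) = 0 := by
  apply H4 k t
  rw [← sub_eq_zero_of_eq h]
  have hyx := rel_yx k t
  have hDx := rel_Dx k t
  have hDy := rel_Dy k t
  have hx := fun p => Arel k t (rel_Ex k t) p
  have hy := fun p => Arel k t (rel_Ey k t) p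
  have hD := fun p => Arel k t (rel_ED k t) p
  have hyx' : ∀ w, y * (x * w) = x * (y * w) := fun w => by rw [← mul_assoc, hyx, mul_assoc]
  have hDx' : ∀ w, D * (x * w) = x * (D * w) := fun w => by rw [← mul_assoc, hDx, mul_assoc]
  have hDy' : ∀ w, D * (y * w) = y * (D * w) + (y * (y * w) + t • (x * (y * w))) := fun w => by
    rw [← mul_assoc, hDy]; simp only [add_mul, mul_assoc, smul_mul_assoc]
  simp only [add_mul, mul_add, mul_assoc, hx, hy, hD, hyx', hDx', hDy', map_add, map_sub,
    map_smul, smul_add, smul_mul_assoc, mul_smul_comm, map_zero, mul_zero, mul_sub]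
  abel

lemma R2 {a1 a2 a3 c1 c2 c3 : Polynomial k}
    (h : (x * A c1 + y * A c2 + D * A c3) * x + D * (x * A a1 + y * A a2 + D * A a3) =
      (x * A a1 + y * A a2 + D * A a3) * D + x * (x * A c1 + y * A c2 + D * A c3)) :
    sh k c1 - c1 = 0 ∧ sh k c2 - c2 + t • a2 = 0 ∧ a2 = 0 ∧ sh k c3 - c3 + a1 - sh k a1 = 0 ∧
      a2 - sh k a2 = 0 ∧ a3 - sh k a3 = 0 := by
  apply H4 k t
  rw [← sub_eq_zero_of_eq h]
  have hyx := rel_yx k t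
  have hDx := rel_Dx k t
  have hDy := rel_Dy k t
  have hx := fun p => Arel k t (rel_Ex k t) p
  have hy := fun p => Arel k t (rel_Ey k t) p
  have hD := fun p => Arel k t (rel_ED k t) p
  have hyx' : ∀ w, y * (x * w) = x * (y * w) := fun w => by rw [← mul_assoc, hyx, mul_assoc]
  have hDx' : ∀ w, D * (x * w) = x * (D * w) := fun w => by rw [← mul_assoc, hDx, mul_assoc]
  have hDy' : ∀ w, D * (y * w) = y * (D * w) + (y * (y * w) + t • (x * (y * w))) := fun w => by
    rw [← mul_assoc, hDy]; simp only [add_mul, mul_assoc, smul_mul_assoc]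
  simp only [add_mul, mul_add, mul_assoc, hx, hy, hD, hyx', hDx', hDy', map_add, map_sub,
    map_smul, smul_mul_assoc, mul_smul_comm, mul_sub]
  abel

lemma R3 {a : Polynomial k} {b1 b2 b3 c1 c2 c3 : k}
    {dx dy dD : DiffA k t}
    (hdx : dx = x * A a) (hdy : dy = b1 • x + (y * A a + b2 • y) + b3 • D)
    (hdD : dD = c1 • x + c2 • y + (D * A a + c3 • D))
    (h : dD * y + D * dy = dy * D + y * dD + (dy * y + y * dy + t • (dx * y + x * dy))) :
    Polynomial.C (t * b1) = 0 ∧ Polynomial.C (2 * b1 - t * c3 + t * b3) = 0 ∧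
    Polynomial.C (b2 - c3 + b3) = 0 ∧ Polynomial.C (t * b3) = 0 ∧ Polynomial.C (2 * b3) = 0 ∧
      (0 : Polynomial k) = 0 := by
  apply H4 k t
  rw [← sub_eq_zero_of_eq h.symm]
  subst hdx hdy hdD
  have hyx := rel_yx k t
  have hDx := rel_Dx k t
  have hDy := rel_Dy k t
  have hx := fun p => Arel k t (rel_Ex k t) p
  have hy := fun p => Arel k t (rel_Ey k t) p
  have hD := fun p => Arel k t (rel_ED k t) p
  have hyx' : ∀ w, y * (x * w) = x * (y * w) := fun w => by rw [← mul_assoc, hyx, mul_assoc]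
  have hDx' : ∀ w, D * (x * w) = x * (D * w) := fun w => by rw [← mul_assoc, hDx, mul_assoc]
  have hDy' : ∀ w, D * (y * w) = y * (D * w) + (y * (y * w) + t • (x * (y * w))) := fun w => by
    rw [← mul_assoc, hDy]; simp only [add_mul, mul_assoc, smul_mul_assoc]
  simp only [add_mul, mul_add, mul_assoc, hx, hy, hD, hyx', hDx', hDy', AC, map_zero, mul_zero,
    smul_mul_assoc, mul_smul_comm, mul_sub, mul_one, hyx, hDx, hDy]
  module

lemma sc {p : Polynomial k} (h : sh k p - p = 0) : ∃ c, p = Polynomial.C c :=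
  shift_const (sub_eq_zero.1 h)

lemma sh_sub (p q : Polynomial k) : sh k (p - q) = sh k p - sh k q := Polynomial.sub_comp ..

lemma N (ht : t ≠ 0) {d : DiffA k t →ₗ[k] DiffA k t} (hd : d ∈ derivations k (DiffA k t))
    (hE : E * d E = d E * E) : ∃ (u : DiffA k t) (c1 c2 c3 : k),
    d x = u * x - x * u ∧ d y = u * y - y * u ∧ d D = u * D - D * u + (c1 • x + c2 • y) ∧
    d E = u * E - E * u + c3 • 1 := by
  obtain ⟨f, hf⟩ := H1 k t hE
  obtain ⟨hx0, hx1⟩ := Nz k t hd hf (rel_Ex k t)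
  obtain ⟨-, hy1⟩ := Nz k t hd hf (rel_Ey k t)
  obtain ⟨-, hD1⟩ := Nz k t hd hf (rel_ED k t)
  obtain ⟨c, rfl⟩ := sc k (p := f) (by rw [← neg_eq_zero, neg_sub]; exact H5 k t hx0)
  obtain ⟨a1, a2, a3, ha⟩ := H2 k t hx1
  obtain ⟨b1, b2, b3, hb⟩ := H2 k t hy1
  obtain ⟨c1, c2, c3, hc⟩ := H2 k t hD1
  have e1 := congrArg d (rel_yx k t)
  rw [hd, hd, ha, hb] at e1
  obtain ⟨r1, r2, r3, r4, r5, -⟩ := R1 k t e1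
  have e2 := congrArg d (rel_Dx k t)
  rw [hd, hd, ha, hc] at e2
  obtain ⟨s1, s2, s3, s4, s5, s6⟩ := R2 k t e2
  subst s3
  have ha3 : a3 = 0 := by
    have : sh k (0 : Polynomial k) = 0 := by simp [sh]
    rw [this] at r3
    linear_combination r5 - r3
  subst ha3
  have z0 : sh k (0 : Polynomial k) = 0 := by simp [sh]
  simp only [z0, smul_zero, sub_zero, add_zero] at r2 s2
  obtain ⟨b1, rfl⟩ := sc k r1
  obtain ⟨b3, rfl⟩ := sc k r4
  obtain ⟨c1, rfl⟩ := sc k s1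
  obtain ⟨c2, rfl⟩ := sc k s2
  obtain ⟨β, hβ⟩ := sc k (p := b2 - a1) (by rw [sh_sub]; linear_combination r2)
  obtain ⟨γ, hγ⟩ := sc k (p := c3 - a1) (by rw [sh_sub]; linear_combination s4)
  obtain rfl : b2 = a1 + Polynomial.C β := by rw [← hβ]; ring
  obtain rfl : c3 = a1 + Polynomial.C γ := by rw [← hγ]; ring
  simp only [map_add, mul_add, AC, mul_smul_comm, mul_one, map_zero, mul_zero, add_zero] at ha hb hc
  have e3 := congrArg d (rel_Dy k t)
  simp only [map_add, map_smul] at e3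
  simp only [hd _ _] at e3
  obtain ⟨q1, q2, q3, q4, -, -⟩ := R3 k t ha hb hc e3
  rw [Polynomial.C_eq_zero] at q1 q2 q3 q4
  obtain rfl : b1 = 0 := by simpa [ht] using q1
  obtain rfl : b3 = 0 := by simpa [ht] using q4
  obtain rfl : γ = 0 := by simpa [ht] using q2
  obtain rfl : β = 0 := by simpa using q3
  obtain ⟨G, rfl⟩ := shift_surj a1
  change d x = x * A (sh k G - G) at ha
  change d y = _ + (y * A (sh k G - G) + _) + _ at hb
  change d D = _ + (D * A (sh k G - G) + _) at hc
  refine ⟨A G, c1, c2, c, ?_, ?_, ?_, ?_⟩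
  · rw [ha, Arel k t (rel_Ex k t), map_sub, mul_sub]
  · rw [hb, Arel k t (rel_Ey k t), map_sub, mul_sub]; simp
  · rw [hc, Arel k t (rel_ED k t), map_sub, mul_sub]; simp; abel
  · rw [hf, AE, AC]; simp

end main
end
end DA


namespace DA

noncomputable section

section fin
variable (k : Type) [Field k] (t : k)

local notation "x" => g k t 0
local notation "y" => g k t 1
local notation "D" => g k t 2
local notation "E" => g k t 3

/-- inner derivation -/
def ad (u : DiffA k t) : DiffA k t →ₗ[k] DiffA k t := LinearMap.mulLeft k u - LinearMap.mulRight k u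

lemma ad_apply (u v : DiffA k t) : ad k t u v = u * v - v * u := by simp [ad]

lemma ad_mem (u : DiffA k t) : ad k t u ∈ derivations k (DiffA k t) := by
  intro a b
  simp only [ad_apply]
  simp only [mul_add, add_mul, mul_sub, sub_mul, mul_assoc]; abel

lemma d_one {d : DiffA k t →ₗ[k] DiffA k t} (hd : d ∈ derivations k (DiffA k t)) : d 1 = 0 := by
  have := hd 1 1
  rw [mul_one, mul_one, one_mul] at this
  simpa using this

lemma der_ext {d e : DiffA k t →ₗ[k] DiffA k t} (hd : d ∈ derivations k (DiffA k t))
    (he : e ∈ derivations k (DiffA k t)) (h0 : d x = e x) (h1 : d y = e y) (h2 : d D = e D)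
    (h3 : d E = e E) : d = e := by
  apply LinearMap.ext
  intro u
  induction u using ind with
  | hs c => rw [Algebra.algebraMap_eq_smul_one, map_smul, map_smul, d_one k t hd, d_one k t he]
  | hg i => fin_cases i <;> assumption
  | hm a b ha hb => rw [hd, he, ha, hb]
  | ha a b ha hb => rw [map_add, map_add, ha, hb]

lemma comm_mem {d e : DiffA k t →ₗ[k] DiffA k t} (hd : d ∈ derivations k (DiffA k t))
    (he : e ∈ derivations k (DiffA k t)) : d ∘ₗ e - e ∘ₗ d ∈ derivations k (DiffA k t) := by
  intro a b
  simp only [LinearMap.sub_apply, LinearMap.comp_apply, hd _ _, he _ _, map_add]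
  simp only [mul_add, add_mul, mul_sub, sub_mul, mul_assoc]; abel

lemma exists_der (c1 c2 c3 : k) : ∃ d ∈ derivations k (DiffA k t),
    d x = 0 ∧ d y = 0 ∧ d D = c1 • x + c2 • y ∧ d E = c3 • 1 := by
  let v : Fin 4 → DiffA k t := ![0, 0, c1 • x + c2 • y, c3 • 1]
  have v0 : v 0 = 0 := rfl
  have v1 : v 1 = 0 := rfl
  have v2 : v 2 = c1 • x + c2 • y := rfl
  have v3 : v 3 = c3 • 1 := rfl
  clear_value v
  let w : Fin 4 → TrivSqZeroExt (DiffA k t) (DiffA k t) := fun i =>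
    TrivSqZeroExt.inl (g k t i) + TrivSqZeroExt.inr (v i)
  have wf : ∀ i, (w i).fst = g k t i := fun i => by simp [w]
  have ws : ∀ i, (w i).snd = v i := fun i => by simp [w]
  clear_value w
  let F : DiffA k t →ₐ[k] TrivSqZeroExt (DiffA k t) (DiffA k t) :=
    RingQuot.liftAlgHom k ⟨FreeAlgebra.lift k w, by
      have hyx := rel_yx k t
      have hDx := rel_Dx k t
      have hDy := rel_Dy k t
      have hEx := rel_Ex k t
      have hEy := rel_Ey k t
      have hED := rel_ED k t
      intro a b h
      induction h <;> apply TrivSqZeroExt.ext <;>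
      simp only [map_mul, map_add, map_smul, FreeAlgebra.lift_ι_apply, TrivSqZeroExt.fst_mul,
        TrivSqZeroExt.snd_mul, TrivSqZeroExt.fst_add, TrivSqZeroExt.snd_add,
        TrivSqZeroExt.fst_smul, TrivSqZeroExt.snd_smul, wf, ws, smul_eq_mul,
        MulOpposite.smul_eq_mul_unop, MulOpposite.unop_op, v0, v1, v2, v3, mul_zero, zero_mul,
        add_zero, zero_add, mul_add, add_mul, smul_mul_assoc, mul_smul_comm, one_mul, mul_one,
        smul_zero, hyx, hDx, hDy, hEx, hEy, hED] <;> module⟩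
  have Fg : ∀ i, F (g k t i) = w i := fun i => by simp [F, g]
  have Ff : ∀ u, (F u).fst = u := by
    intro u
    induction u using ind with
    | hs c => rw [AlgHom.commutes]; rfl
    | hg i => rw [Fg, wf]
    | hm a b ha hb => rw [map_mul, TrivSqZeroExt.fst_mul, ha, hb]
    | ha a b ha hb => rw [map_add, TrivSqZeroExt.fst_add, ha, hb]
  refine ⟨(TrivSqZeroExt.sndHom (DiffA k t) (DiffA k t)).restrictScalars k ∘ₗ F.toLinearMap,
    ?_, ?_, ?_, ?_, ?_⟩
  · intro a b
    change (F (a * b)).snd = (F a).snd * b + a * (F b).snd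
    rw [map_mul, TrivSqZeroExt.snd_mul, Ff, Ff, add_comm]
    rfl
  all_goals simp [Fg, ws, *]

variable [CharZero k]

lemma classify (ht : t ≠ 0) {d : DiffA k t →ₗ[k] DiffA k t} (hd : d ∈ derivations k (DiffA k t)) :
    ∃ (u : DiffA k t) (c1 c2 c3 : k),
    d x = u * x - x * u ∧ d y = u * y - y * u ∧ d D = u * D - D * u + (c1 • x + c2 • y) ∧
    d E = u * E - E * u + c3 • 1 := by
  obtain ⟨u, hu⟩ := H0 k t (d E)
  have h := (derivations k (DiffA k t)).add_mem hd (ad_mem k t u)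
  obtain ⟨v, c1, c2, c3, h0, h1, h2, h3⟩ := N k t ht h (by
    rw [LinearMap.add_apply, ad_apply]
    have : d E + (u * E - E * u) = d E - (E * u - u * E) := by abel
    rw [this, hu])
  simp only [LinearMap.add_apply, ad_apply] at h0 h1 h2 h3
  refine ⟨v - u, c1, c2, c3, ?_, ?_, ?_, ?_⟩
  · rw [eq_sub_of_add_eq h0]; simp only [mul_add, add_mul, mul_sub, sub_mul, mul_assoc]; abel
  · rw [eq_sub_of_add_eq h1]; simp only [mul_add, add_mul, mul_sub, sub_mul, mul_assoc]; abel
  · rw [eq_sub_of_add_eq h2]; simp only [sub_mul, mul_sub]; abel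
  · rw [eq_sub_of_add_eq h3]; simp only [sub_mul, mul_sub]; abel

lemma gen_comm {k U : Type*} [Field k] [Ring U] [Algebra k U] {e u : U} {c : k}
    (h : u * e - e * u = c • 1) : e * (e * u - u * e) = (e * u - u * e) * e := by
  have e1 : e * u - u * e = - (c • 1) := by rw [← h]; abel
  rw [e1, mul_neg, neg_mul, mul_smul_comm, smul_mul_assoc, mul_one, one_mul]

lemma indep {c1 c2 c3 : k} {u : DiffA k t} (h0 : u * x - x * u = 0)
    (h2 : u * D - D * u = c1 • x + c2 • y) (h3 : u * E - E * u = c3 • 1) :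
    c1 = 0 ∧ c2 = 0 ∧ c3 = 0 := by
  have h := H6 k t (u := u) (gen_comm h3)
  have hc3 : c3 = 0 := by
    rw [h, sub_self] at h3
    have := H5 k t (p := Polynomial.C c3) (by rw [AC, ← h3, mul_zero])
    simpa using this
  obtain ⟨G, rfl⟩ := H1 k t h
  rw [Arel k t (rel_Ex k t), ← mul_sub, ← map_sub] at h0
  obtain ⟨c, rfl⟩ := sc k (H5 k t h0)
  rw [AC] at h2
  have h4 : c1 • x + c2 • y = 0 := by rw [← h2]; simp
  have h5 := congrArg (fun z => x * z) h4
  obtain ⟨q1, q2, -⟩ := H4 k t (p1 := Polynomial.C c1) (p2 := Polynomial.C c2) (p3 := 0) (p4 := 0)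
    (p5 := 0) (p6 := 0) (by
      simp only [AC, mul_smul_comm, mul_one, map_zero, mul_zero, add_zero]
      simpa [mul_add] using h5)
  exact ⟨by simpa using q1, by simpa using q2, hc3⟩

lemma partB (ht : t ≠ 0) {d e : DiffA k t →ₗ[k] DiffA k t} (hd : d ∈ derivations k (DiffA k t))
    (he : e ∈ derivations k (DiffA k t)) :
    d ∘ₗ e - e ∘ₗ d ∈ innerDerivations k (DiffA k t) := by
  obtain ⟨u, a1, a2, a3, hd0, hd1, hd2, hd3⟩ := classify k t ht hd
  obtain ⟨v, b1, b2, b3, he0, he1, he2, he3⟩ := classify k t ht he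
  have : d ∘ₗ e - e ∘ₗ d = ad k t (d v - e u - (u * v - v * u)) := by
    have hd' := d_one k t hd
    have he' := d_one k t he
    apply der_ext k t (comm_mem k t hd he) (ad_mem k t _) <;>
    · simp only [LinearMap.sub_apply, LinearMap.comp_apply, ad_apply, hd0, hd1, hd2, hd3, he0, he1,
        he2, he3, map_add, map_sub, map_smul, hd _ _, he _ _, hd', he']
      simp only [mul_add, add_mul, mul_sub, sub_mul, smul_add, smul_sub, smul_mul_assoc,
        mul_smul_comm, mul_assoc, mul_one, one_mul, smul_zero]
      abel
  rw [this]
  exact ⟨_, fun v => ad_apply k t _ v⟩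

set_option maxSynthPendingDepth 3

lemma partA (ht : t ≠ 0) : Module.finrank k
      (↥(derivations k (DiffA k t)) ⧸
        Submodule.comap (derivations k (DiffA k t)).subtype
          (innerDerivations k (DiffA k t))) = 3 := by
  obtain ⟨d1, m1, h10, h11, h12, h13⟩ := exists_der k t 1 0 0
  obtain ⟨d2, m2, h20, h21, h22, h23⟩ := exists_der k t 0 1 0
  obtain ⟨d3, m3, h30, h31, h32, h33⟩ := exists_der k t 0 0 1
  let L0 : (Fin 3 → k) →ₗ[k] derivations k (DiffA k t) :=
    Fintype.linearCombination k ![⟨d1, m1⟩, ⟨d2, m2⟩, ⟨d3, m3⟩]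
  have hL0 : ∀ c, (L0 c : DiffA k t →ₗ[k] DiffA k t) = c 0 • d1 + c 1 • d2 + c 2 • d3 := by
    intro c
    simp [L0, Fintype.linearCombination_apply, Fin.sum_univ_three]
  clear_value L0
  let L := (Submodule.mkQ (Submodule.comap (derivations k (DiffA k t)).subtype
          (innerDerivations k (DiffA k t)))) ∘ₗ L0
  have hL : Function.Bijective L := by
    constructor
    · rw [← LinearMap.ker_eq_bot, LinearMap.ker_eq_bot']
      intro c hc
      rw [LinearMap.comp_apply, Submodule.mkQ_apply, Submodule.Quotient.mk_eq_zero,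
        Submodule.mem_comap] at hc
      obtain ⟨u, hu⟩ := hc
      rw [Submodule.subtype_apply, hL0] at hu
      obtain ⟨q1, q2, q3⟩ := indep k t (c1 := c 0) (c2 := c 1) (c3 := c 2) (u := u)
        (by rw [← hu]; simp [h10, h20, h30]) (by rw [← hu]; simp [h12, h22, h32])
        (by rw [← hu]; simp [h13, h23, h33])
      ext i
      fin_cases i <;> assumption
    · intro q
      obtain ⟨⟨d, hd⟩, rfl⟩ := Submodule.mkQ_surjective _ q
      obtain ⟨u, a1, a2, a3, hd0, hd1, hd2, hd3⟩ := classify k t ht hd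
      refine ⟨![a1, a2, a3], ?_⟩
      rw [LinearMap.comp_apply, Submodule.mkQ_apply, Submodule.mkQ_apply, eq_comm,
        Submodule.Quotient.eq, Submodule.mem_comap]
      refine ⟨u, fun v => ?_⟩
      rw [map_sub, Submodule.subtype_apply, Submodule.subtype_apply, ← ad_apply]
      have : d = ad k t u + (L0 ![a1, a2, a3] : DiffA k t →ₗ[k] DiffA k t) := by
        apply der_ext k t hd ((derivations k (DiffA k t)).add_mem (ad_mem k t u)
          (L0 ![a1, a2, a3]).2) <;> rw [hL0] <;> simp [ad_apply, *]
      change (d - (L0 ![a1, a2, a3] : DiffA k t →ₗ[k] DiffA k t)) v = _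
      rw [this]
      simp
  have := (LinearEquiv.ofBijective L hL).finrank_eq
  rw [← this]
  simp

end fin
end
end DA


/-- The Lie algebra of outer derivations of `Diff 𝒜`, for `𝒜` a central arrangement of
three lines, is abelian of dimension three: (a) the quotient of the space of derivations
by the subspace of inner derivations has `k`-dimension `3`; (b) the commutator of any two
derivations is inner. -/
theorem outer_derivations_DiffA_abelian_dim_three
    (k : Type) [Field k] [CharZero k] (t : k) (ht : t ≠ 0) :
    Module.finrank k
      (↥(derivations k (DiffA k t)) ⧸
        Submodule.comap (derivations k (DiffA k t)).subtype
          (innerDerivations k (DiffA k t))) = 3 ∧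
    ∀ d₁ d₂ : DiffA k t →ₗ[k] DiffA k t,
      d₁ ∈ derivations k (DiffA k t) → d₂ ∈ derivations k (DiffA k t) →
        d₁ ∘ₗ d₂ - d₂ ∘ₗ d₁ ∈ innerDerivations k (DiffA k t) := by
  exact ⟨DA.partA k t ht, fun d₁ d₂ h₁ h₂ => DA.partB k t ht h₁ h₂⟩
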